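/- For all (t,R) ∈ [0,1] × (0,∞)², in the (t,R)-parametrized model one has E⟨𝓛⟩_{t,R} = −(α_u/2)(n_v/n) E⟨Q_v⟩_{t,R}, and the fluctuation of the overlap is controlled by that of 𝓛: E⟨ (Q_v − E⟨Q_v⟩_{t,R})² ⟩_{t,R} ≤ (4/α_u²)(n/n_v)² · E⟨ (𝓛 − E⟨𝓛⟩_{t,R})² ⟩_{t,R}. -/

import Mathlib

open MeasureTheory Real Filter Set

noncomputable section

/-- i.i.d. standard Gaussian measure on `Fin n → ℝ`. -/
def stdGaussian (n : ℕ) : Measure (Fin n → ℝ) :=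
  Measure.pi fun _ : Fin n => ProbabilityTheory.gaussianReal 0 1

/-- i.i.d. standard Gaussian measure on matrices `Fin p → Fin q → ℝ`. -/
def stdGaussianMat (p q : ℕ) : Measure (Fin p → Fin q → ℝ) :=
  Measure.pi fun _ : Fin p => stdGaussian q

/-- `P` is the uniform (rotation-invariant) probability measure on the sphere of
radius `r` centered at the origin in `ℝⁿ`. -/
def IsUniformSphere (n : ℕ) (r : ℝ) (P : Measure (Fin n → ℝ)) : Prop :=
  IsProbabilityMeasure P ∧
  (∀ᵐ x ∂P, ∑ i, (x i) ^ 2 = r ^ 2) ∧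
  ∀ O : Matrix (Fin n) (Fin n) ℝ, O ∈ Matrix.orthogonalGroup (Fin n) ℝ →
    P.map (fun x => O.mulVec x) = P

/-- The interpolating Hamiltonian `H_{t,R}(u,v)`, with the observations
`Y^{(t)} = √((1−t)/n) U Vᵀ + Z`, `Ỹ = √(α_v R_v) U + Z̃`, `Ȳ = √(α_u R_u) V + Z̄`
substituted. -/
def interpH (n nu nv : ℕ) (au av t Ru Rv : ℝ)
    (U : Fin nu → ℝ) (V : Fin nv → ℝ) (Z : Fin nu → Fin nv → ℝ)
    (Zt : Fin nu → ℝ) (Zb : Fin nv → ℝ)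
    (u : Fin nu → ℝ) (v : Fin nv → ℝ) : ℝ :=
  (∑ i, ∑ j, ((1 - t) / (2 * n) * (u i) ^ 2 * (v j) ^ 2
      - Real.sqrt ((1 - t) / n) * u i * v j
          * (Real.sqrt ((1 - t) / n) * U i * V j + Z i j)))
  + (∑ i, (av * Rv / 2 * (u i) ^ 2
      - Real.sqrt (av * Rv) * u i * (Real.sqrt (av * Rv) * U i + Zt i)))
  + (∑ j, (au * Ru / 2 * (v j) ^ 2
      - Real.sqrt (au * Ru) * v j * (Real.sqrt (au * Ru) * V j + Zb j)))

/-- The partition function `Z_{t,R} = ∫∫ e^{−H_{t,R}(u,v)} dP_u(u) dP_v(v)`. -/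
def partFun (n nu nv : ℕ) (au av t Ru Rv : ℝ)
    (Pu : Measure (Fin nu → ℝ)) (Pv : Measure (Fin nv → ℝ))
    (U : Fin nu → ℝ) (V : Fin nv → ℝ) (Z : Fin nu → Fin nv → ℝ)
    (Zt : Fin nu → ℝ) (Zb : Fin nv → ℝ) : ℝ :=
  ∫ u, (∫ v, Real.exp (-(interpH n nu nv au av t Ru Rv U V Z Zt Zb u v)) ∂Pv) ∂Pu

/-- The Gibbs bracket `⟨f⟩_{t,R}`, i.e. the expectation of `f(u,v)` under the
posterior measure proportional to `e^{−H_{t,R}(u,v)} dP_u(u) dP_v(v)`. -/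
def gibbs (n nu nv : ℕ) (au av t Ru Rv : ℝ)
    (Pu : Measure (Fin nu → ℝ)) (Pv : Measure (Fin nv → ℝ))
    (U : Fin nu → ℝ) (V : Fin nv → ℝ) (Z : Fin nu → Fin nv → ℝ)
    (Zt : Fin nu → ℝ) (Zb : Fin nv → ℝ)
    (f : (Fin nu → ℝ) → (Fin nv → ℝ) → ℝ) : ℝ :=
  (∫ u, (∫ v, f u v * Real.exp (-(interpH n nu nv au av t Ru Rv U V Z Zt Zb u v)) ∂Pv) ∂Pu)
    / partFun n nu nv au av t Ru Rv Pu Pv U V Z Zt Zb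

/-- Expectation `E` over all the randomness `U ~ P_u`, `V ~ P_v` and the independent
standard Gaussian noises `Z, Z̃, Z̄`. -/
def Efull (nu nv : ℕ)
    (Pu : Measure (Fin nu → ℝ)) (Pv : Measure (Fin nv → ℝ))
    (g : (Fin nu → ℝ) → (Fin nv → ℝ) → (Fin nu → Fin nv → ℝ) →
      (Fin nu → ℝ) → (Fin nv → ℝ) → ℝ) : ℝ :=
  ∫ U, (∫ V, (∫ Z, (∫ Zt, (∫ Zb, g U V Z Zt Zb
    ∂(stdGaussian nv)) ∂(stdGaussian nu)) ∂(stdGaussianMat nu nv)) ∂Pv) ∂Pu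

/-- The average interpolating free entropy `fₙ(t,R) = (1/n) E ln Z_{t,R}`. -/
def interpFreeEntropy (n nu nv : ℕ) (au av t Ru Rv : ℝ)
    (Pu : Measure (Fin nu → ℝ)) (Pv : Measure (Fin nv → ℝ)) : ℝ :=
  (1 / (n : ℝ)) * Efull nu nv Pu Pv (fun U V Z Zt Zb =>
    Real.log (partFun n nu nv au av t Ru Rv Pu Pv U V Z Zt Zb))

/-- The overlap `Q_u = (1/n_u) Σ_i u_i U_i`. -/
def overlapU (nu : ℕ) (u U : Fin nu → ℝ) : ℝ := (1 / (nu : ℝ)) * ∑ i, u i * U i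

/-- The overlap `Q_v = (1/n_v) Σ_j v_j V_j`. -/
def overlapV (nv : ℕ) (v V : Fin nv → ℝ) : ℝ := (1 / (nv : ℝ)) * ∑ j, v j * V j

/-- `E⟨Q_v⟩_{t,R}`. -/
def eQv (n nu nv : ℕ) (au av t Ru Rv : ℝ)
    (Pu : Measure (Fin nu → ℝ)) (Pv : Measure (Fin nv → ℝ)) : ℝ :=
  Efull nu nv Pu Pv (fun U V Z Zt Zb =>
    gibbs n nu nv au av t Ru Rv Pu Pv U V Z Zt Zb (fun _ v => overlapV nv v V))

/-- `E⟨Q_u⟩_{t,R}`. -/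
def eQu (n nu nv : ℕ) (au av t Ru Rv : ℝ)
    (Pu : Measure (Fin nu → ℝ)) (Pv : Measure (Fin nv → ℝ)) : ℝ :=
  Efull nu nv Pu Pv (fun U V Z Zt Zb =>
    gibbs n nu nv au av t Ru Rv Pu Pv U V Z Zt Zb (fun u _ => overlapU nu u U))

/-- The quantity `𝓛 = (1/n) Σ_j [(α_u/2)v_j² − α_u v_j V_j − (1/2)√(α_u/R_u) v_j Z̄_j]`. -/
def calL (n nv : ℕ) (au Ru : ℝ) (v V Zb : Fin nv → ℝ) : ℝ :=
  (1 / (n : ℝ)) * ∑ j, (au / 2 * (v j) ^ 2 - au * v j * V j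
    - 1 / 2 * Real.sqrt (au / Ru) * v j * Zb j)

/-- `E⟨𝓛⟩_{t,R}`. -/
def eL (n nu nv : ℕ) (au av t Ru Rv : ℝ)
    (Pu : Measure (Fin nu → ℝ)) (Pv : Measure (Fin nv → ℝ)) : ℝ :=
  Efull nu nv Pu Pv (fun U V Z Zt Zb =>
    gibbs n nu nv au av t Ru Rv Pu Pv U V Z Zt Zb (fun _ v => calL n nv au Ru v V Zb))

/-- `φ₀(m) = (m − ln(1+m))/2`. -/
def phi0 (m : ℝ) : ℝ := (m - Real.log (1 + m)) / 2


section PosteriorSampling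

variable {X W : Type*} [MeasurableSpace X] [MeasurableSpace W] {P : Measure X}
  [IsProbabilityMeasure P] {γ : Measure W} {m : X → W} {Λ : X → W → ℝ}

lemma measurable_integral_exp (hΛ : Measurable fun p : X × W => Λ p.1 p.2) :
    Measurable fun y => ∫ x, exp (Λ x y) ∂P := by
  have h : StronglyMeasurable (Function.uncurry fun (y : W) (x : X) => exp (Λ x y)) :=
    (measurable_exp.comp (hΛ.comp measurable_swap)).stronglyMeasurable
  exact h.integral_prod_right.measurable

lemma measurable_posterior_density (hΛ : Measurable fun p : X × W => Λ p.1 p.2) :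
    Measurable fun p : X × W => exp (Λ p.1 p.2) / ∫ x, exp (Λ x p.2) ∂P :=
  (measurable_exp.comp hΛ).div ((measurable_integral_exp hΛ).comp measurable_snd)

variable [Add W]

/-- The joint law of (signal, noise, posterior sample) in the additive channel `y = z + m x`, where
`Λ x y` is the log-likelihood of the signal `x` given the observation `y`. -/
def posteriorLaw (P : Measure X) (γ : Measure W) (m : X → W) (Λ : X → W → ℝ) :
    Measure ((X × W) × X) :=
  ((P.prod γ).prod P).withDensity fun ω =>
    ENNReal.ofReal (exp (Λ ω.2 (ω.1.2 + m ω.1.1)) / ∫ x, exp (Λ x (ω.1.2 + m ω.1.1)) ∂P)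

variable [MeasurableAdd₂ W]

lemma measurable_sample_observation (hm : Measurable m) :
    Measurable fun ω : (X × W) × X => (ω.2, ω.1.2 + m ω.1.1) := by
  fun_prop

lemma measurable_signal_observation (hm : Measurable m) :
    Measurable fun ω : (X × W) × X => (ω.1.1, ω.2, ω.1.2 + m ω.1.1) := by
  fun_prop

lemma measurable_posteriorLaw_density (hm : Measurable m)
    (hΛ : Measurable fun p : X × W => Λ p.1 p.2) :
    Measurable fun ω : (X × W) × X =>
      exp (Λ ω.2 (ω.1.2 + m ω.1.1)) / ∫ x, exp (Λ x (ω.1.2 + m ω.1.1)) ∂P :=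
  (measurable_posterior_density hΛ).comp (measurable_sample_observation hm)

lemma integrable_density_mul (hm : Measurable m) (hΛ : Measurable fun p : X × W => Λ p.1 p.2)
    {F : (X × W) × X → ℝ} (hF : Integrable F (posteriorLaw P γ m Λ)) :
    Integrable (fun ω => F ω * exp (Λ ω.2 (ω.1.2 + m ω.1.1)) /
      ∫ x, exp (Λ x (ω.1.2 + m ω.1.1)) ∂P) ((P.prod γ).prod P) := by
  have hdens := (measurable_posteriorLaw_density (P := P) hm hΛ).ennreal_ofReal
  rw [posteriorLaw, integrable_withDensity_iff_integrable_smul' hdens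
    (Eventually.of_forall fun _ => ENNReal.ofReal_lt_top)] at hF
  refine hF.congr (Eventually.of_forall fun ω => ?_)
  simp only [smul_eq_mul]
  rw [ENNReal.toReal_ofReal (div_nonneg (exp_pos _).le (integral_nonneg fun _ => (exp_pos _).le))]
  ring

lemma map_fst_posteriorLaw (hm : Measurable m) (hΛ : Measurable fun p : X × W => Λ p.1 p.2)
    (hexp : ∀ y, Integrable (fun x => exp (Λ x y)) P) :
    (posteriorLaw P γ m Λ).map Prod.fst = P.prod γ := by
  have hdens := (measurable_posteriorLaw_density (P := P) hm hΛ).ennreal_ofReal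
  refine Measure.ext_of_lintegral _ fun f hf => ?_
  have hF : Measurable fun ω : (X × W) × X => f ω.1 := hf.comp measurable_fst
  rw [lintegral_map hf measurable_fst, posteriorLaw,
    lintegral_withDensity_eq_lintegral_mul _ hdens hF,
    lintegral_prod _ (hdens.mul hF).aemeasurable]
  refine lintegral_congr fun p => ?_
  simp only [Pi.mul_apply]
  have hdens_p := hdens.comp (measurable_prodMk_left (x := p))
  simp only [Function.comp_def] at hdens_p
  rw [lintegral_mul_const _ hdens_p,
    ← ofReal_integral_eq_lintegral_ofReal ((hexp _).div_const _)
      (Eventually.of_forall fun x => div_nonneg (exp_pos _).le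
        (integral_nonneg fun _ => (exp_pos _).le)), integral_div, div_self, ENNReal.ofReal_one,
    one_mul]
  exact (integral_exp_pos (hexp _)).ne'

variable [IsProbabilityMeasure γ]

lemma lintegral_posteriorLaw (hm : Measurable m) (hΛ : Measurable fun p : X × W => Λ p.1 p.2)
    (hshift : ∀ x, γ.map (· + m x) = γ.withDensity fun y => ENNReal.ofReal (exp (Λ x y)))
    {f : X × X × W → ENNReal} (hf : Measurable f) :
    ∫⁻ ω, f (ω.1.1, ω.2, ω.1.2 + m ω.1.1) ∂(posteriorLaw P γ m Λ) =
      ∫⁻ x, ∫⁻ y, ∫⁻ x', ENNReal.ofReal (exp (Λ x y) * exp (Λ x' y) / ∫ x, exp (Λ x y) ∂P)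
        * f (x, x', y) ∂P ∂γ ∂P := by
  have hD := measurable_posterior_density (P := P) hΛ
  have hg : Measurable fun p : X × W × X =>
      ENNReal.ofReal (exp (Λ p.2.2 p.2.1) / ∫ x, exp (Λ x p.2.1) ∂P) * f (p.1, p.2.2, p.2.1) := by
    refine Measurable.mul (ENNReal.measurable_ofReal.comp ?_) (hf.comp (by fun_prop))
    exact hD.comp (by fun_prop : Measurable fun p : X × W × X => (p.2.2, p.2.1))
  have hF : Measurable fun ω : (X × W) × X => f (ω.1.1, ω.2, ω.1.2 + m ω.1.1) :=
    hf.comp (measurable_signal_observation hm)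
  have hdens := (measurable_posteriorLaw_density (P := P) hm hΛ).ennreal_ofReal
  rw [posteriorLaw, lintegral_withDensity_eq_lintegral_mul _ hdens hF,
    lintegral_prod _ (hdens.mul hF).aemeasurable,
    lintegral_prod _ (hdens.mul hF).lintegral_prod_right'.aemeasurable]
  refine lintegral_congr fun x => ?_
  have hgx : Measurable fun y => ∫⁻ x', ENNReal.ofReal (exp (Λ x' y) / ∫ x, exp (Λ x y) ∂P)
      * f (x, x', y) ∂P :=
    Measurable.lintegral_prod_right' (f := fun p : W × X =>
      ENNReal.ofReal (exp (Λ p.2 p.1) / ∫ x, exp (Λ x p.1) ∂P) * f (x, p.2, p.1))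
      (hg.comp measurable_prodMk_left)
  have hE : Measurable fun y => ENNReal.ofReal (exp (Λ x y)) :=
    (measurable_exp.comp (hΛ.comp measurable_prodMk_left)).ennreal_ofReal
  have h1 : ∫⁻ z, (∫⁻ x', ENNReal.ofReal (exp (Λ x' (z + m x)) / ∫ x', exp (Λ x' (z + m x)) ∂P)
      * f (x, x', z + m x) ∂P) ∂γ = _ :=
    (lintegral_map hgx (measurable_add_const (m x))).symm
  refine h1.trans ?_
  rw [hshift x, lintegral_withDensity_eq_lintegral_mul _ hE hgx]
  refine lintegral_congr fun y => ?_
  rw [Pi.mul_apply, ← lintegral_const_mul']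
  · refine lintegral_congr fun x' => ?_
    rw [← mul_assoc, ← ENNReal.ofReal_mul (exp_pos _).le, mul_div_assoc]
  · exact ENNReal.ofReal_ne_top

/-- The Nishimori identity: signal and posterior sample are exchangeable given the observation. -/
lemma map_posteriorLaw_swap (hm : Measurable m) (hΛ : Measurable fun p : X × W => Λ p.1 p.2)
    (hshift : ∀ x, γ.map (· + m x) = γ.withDensity fun y => ENNReal.ofReal (exp (Λ x y))) :
    (posteriorLaw P γ m Λ).map (fun ω => (ω.1.1, ω.2, ω.1.2 + m ω.1.1)) =
      (posteriorLaw P γ m Λ).map (fun ω => (ω.2, ω.1.1, ω.1.2 + m ω.1.1)) := by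
  have hT := measurable_signal_observation hm
  have hS : Measurable fun ω : (X × W) × X => (ω.2, ω.1.1, ω.1.2 + m ω.1.1) := by fun_prop
  refine Measure.ext_of_lintegral _ fun f hf => ?_
  rw [lintegral_map hf hT, lintegral_map hf hS, lintegral_posteriorLaw hm hΛ hshift hf]
  have hf' : Measurable fun p : X × X × W => f (p.2.1, p.1, p.2.2) := hf.comp (by fun_prop)
  rw [lintegral_posteriorLaw hm hΛ hshift hf']
  have hΛ1 : Measurable fun p : X × W × X => Λ p.1 p.2.1 :=
    hΛ.comp (by fun_prop : Measurable fun p : X × W × X => (p.1, p.2.1))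
  have hΛ2 : Measurable fun p : X × W × X => Λ p.2.2 p.2.1 :=
    hΛ.comp (by fun_prop : Measurable fun p : X × W × X => (p.2.2, p.2.1))
  have hZ : Measurable fun p : X × W × X => ∫ x, exp (Λ x p.2.1) ∂P :=
    (measurable_integral_exp hΛ).comp (by fun_prop)
  have hw : Measurable fun p : X × W × X =>
      ENNReal.ofReal (exp (Λ p.1 p.2.1) * exp (Λ p.2.2 p.2.1) / ∫ x, exp (Λ x p.2.1) ∂P) :=
    ((hΛ1.exp.mul hΛ2.exp).div hZ).ennreal_ofReal
  have key : ∀ g : X × X × W → ENNReal, Measurable g →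
      ∫⁻ x, ∫⁻ y, ∫⁻ x', ENNReal.ofReal (exp (Λ x y) * exp (Λ x' y) / ∫ x, exp (Λ x y) ∂P)
        * g (x, x', y) ∂P ∂γ ∂P =
      ∫⁻ y, ∫⁻ x, ∫⁻ x', ENNReal.ofReal (exp (Λ x y) * exp (Λ x' y) / ∫ x, exp (Λ x y) ∂P)
        * g (x, x', y) ∂P ∂P ∂γ := by
    intro g hg
    refine lintegral_lintegral_swap (Measurable.aemeasurable ?_)
    refine Measurable.lintegral_prod_right' (f := fun p : (X × W) × X =>
      ENNReal.ofReal (exp (Λ p.1.1 p.1.2) * exp (Λ p.2 p.1.2) / ∫ x, exp (Λ x p.1.2) ∂P)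
        * g (p.1.1, p.2, p.1.2)) ?_
    exact (hw.comp (by fun_prop : Measurable fun p : (X × W) × X => (p.1.1, p.1.2, p.2))).mul
      (hg.comp (by fun_prop))
  rw [key f hf, key _ hf']
  refine lintegral_congr fun y => ?_
  rw [lintegral_lintegral_swap]
  · refine lintegral_congr fun x' => lintegral_congr fun x => ?_
    rw [mul_comm (exp (Λ x y))]
  · refine Measurable.aemeasurable (Measurable.mul ?_ (hf.comp (by fun_prop)))
    exact hw.comp (by fun_prop : Measurable fun p : X × X => (p.1, y, p.2))

lemma integral_posteriorLaw_swap (hm : Measurable m) (hΛ : Measurable fun p : X × W => Λ p.1 p.2)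
    (hshift : ∀ x, γ.map (· + m x) = γ.withDensity fun y => ENNReal.ofReal (exp (Λ x y)))
    {f : X → X → W → ℝ} (hf : Measurable fun p : X × X × W => f p.1 p.2.1 p.2.2) :
    ∫ ω, f ω.1.1 ω.2 (ω.1.2 + m ω.1.1) ∂(posteriorLaw P γ m Λ) =
      ∫ ω, f ω.2 ω.1.1 (ω.1.2 + m ω.1.1) ∂(posteriorLaw P γ m Λ) := by
  have hS : Measurable fun ω : (X × W) × X => (ω.2, ω.1.1, ω.1.2 + m ω.1.1) := by fun_prop
  have h1 := integral_map (μ := posteriorLaw P γ m Λ)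
    (measurable_signal_observation hm).aemeasurable hf.aestronglyMeasurable
  have h2 := integral_map (μ := posteriorLaw P γ m Λ) hS.aemeasurable hf.aestronglyMeasurable
  rw [map_posteriorLaw_swap hm hΛ hshift] at h1
  exact h1.symm.trans h2

/-- The expectation of the posterior average is the integral under the joint law. -/
lemma integral_posteriorLaw (hm : Measurable m) (hΛ : Measurable fun p : X × W => Λ p.1 p.2)
    {F : (X × W) × X → ℝ} (hF : Integrable F (posteriorLaw P γ m Λ)) :
    ∫ ω, F ω ∂(posteriorLaw P γ m Λ) =
      ∫ p, (∫ x, F (p, x) * exp (Λ x (p.2 + m p.1)) ∂P) / ∫ x, exp (Λ x (p.2 + m p.1)) ∂P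
        ∂(P.prod γ) := by
  have hdens := (measurable_posteriorLaw_density (P := P) hm hΛ).ennreal_ofReal
  have hint := integrable_density_mul hm hΛ hF
  rw [posteriorLaw, integral_withDensity_eq_integral_toReal_smul hdens
    (Eventually.of_forall fun _ => ENNReal.ofReal_lt_top)]
  have : ∀ ω : (X × W) × X, (ENNReal.ofReal (exp (Λ ω.2 (ω.1.2 + m ω.1.1)) /
      ∫ x, exp (Λ x (ω.1.2 + m ω.1.1)) ∂P)).toReal • F ω = F ω * exp (Λ ω.2 (ω.1.2 + m ω.1.1)) /
      ∫ x, exp (Λ x (ω.1.2 + m ω.1.1)) ∂P := fun ω => by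
    rw [ENNReal.toReal_ofReal (div_nonneg (exp_pos _).le (integral_nonneg fun _ => (exp_pos _).le)),
      smul_eq_mul]
    ring
  simp_rw [this]
  rw [integral_prod _ hint]
  simp_rw [integral_div]

end PosteriorSampling

section GaussianShift

open ProbabilityTheory hiding stdGaussian

lemma pi_withDensity_prod {ι : Type*} [Fintype ι] {E : ι → Type*} [∀ i, MeasurableSpace (E i)]
    (μ : ∀ i, Measure (E i)) [∀ i, IsProbabilityMeasure (μ i)] {f : ∀ i, E i → ENNReal}
    (hf : ∀ i, Measurable (f i)) [∀ i, SigmaFinite ((μ i).withDensity (f i))] :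
    Measure.pi (fun i => (μ i).withDensity (f i)) =
      (Measure.pi μ).withDensity fun x => ∏ i, f i (x i) := by
  classical
  refine Measure.pi_eq fun s hs => ?_
  have hg : ∀ i, Measurable ((s i).indicator (f i)) := fun i => (hf i).indicator (hs i)
  have hind : iIndepFun (fun i (x : ∀ i, E i) => (s i).indicator (f i) (x i)) (Measure.pi μ) :=
    iIndepFun_pi (X := fun i => (s i).indicator (f i)) fun i => (hg i).aemeasurable
  have hprod := lintegral_prod_eq_prod_lintegral_of_indepFun (μ := Measure.pi μ) Finset.univ _ hind
    fun i => (hg i).comp (measurable_pi_apply i)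
  rw [withDensity_apply _ (MeasurableSet.univ_pi hs),
    ← lintegral_indicator (MeasurableSet.univ_pi hs)]
  have hprod' : ∀ x : ∀ i, E i, (Set.univ.pi s).indicator (fun x => ∏ i, f i (x i)) x =
      ∏ i, (s i).indicator (f i) (x i) := by
    intro x
    by_cases hx : x ∈ Set.univ.pi s
    · rw [Set.indicator_of_mem hx]
      exact Finset.prod_congr rfl fun i _ => (Set.indicator_of_mem (hx i (Set.mem_univ i)) _).symm
    · rw [Set.indicator_of_notMem hx]
      simp only [Set.mem_univ_pi, not_forall] at hx
      obtain ⟨i, hi⟩ := hx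
      exact (Finset.prod_eq_zero (Finset.mem_univ i) (Set.indicator_of_notMem hi _)).symm
  simp_rw [hprod']
  rw [hprod]
  refine Finset.prod_congr rfl fun i _ => ?_
  rw [withDensity_apply _ (hs i), ← lintegral_indicator (hs i),
    ← lintegral_map (hg i) (measurable_pi_apply i),
    (measurePreserving_eval μ i).map_eq]

lemma gaussianReal_map_add_eq_withDensity (c : ℝ) :
    (gaussianReal 0 1).map (· + c) =
      (gaussianReal 0 1).withDensity fun y => ENNReal.ofReal (exp (c * y - c ^ 2 / 2)) := by
  rw [gaussianReal_map_add_const, gaussianReal_of_var_ne_zero _ one_ne_zero,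
    gaussianReal_of_var_ne_zero _ one_ne_zero,
    ← withDensity_mul _ (measurable_gaussianPDF _ _) (by fun_prop)]
  congr 1
  ext y
  simp only [gaussianPDF, gaussianPDFReal, Pi.mul_apply]
  rw [← ENNReal.ofReal_mul (by positivity), mul_assoc (_⁻¹), ← Real.exp_add]
  congr 3
  simp
  ring

instance isProbabilityMeasure_stdGaussian_pi (k : ℕ) : IsProbabilityMeasure (stdGaussian k) := by
  unfold stdGaussian; infer_instance

instance isProbabilityMeasure_stdGaussianMat (p q : ℕ) :
    IsProbabilityMeasure (stdGaussianMat p q) := by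
  unfold stdGaussianMat; infer_instance

/-- Shifts of product measures have product densities. -/
lemma pi_map_add_eq_withDensity {ι E : Type*} [Fintype ι] [MeasurableSpace E] [Add E]
    [MeasurableAdd₂ E] (μ : Measure E) [IsProbabilityMeasure μ] {l : E → E → ℝ}
    (hl : ∀ c, Measurable (l c))
    (h : ∀ c, μ.map (· + c) = μ.withDensity fun y => ENNReal.ofReal (exp (l c y))) (c : ι → E) :
    (Measure.pi fun _ : ι => μ).map (· + c) =
      (Measure.pi fun _ : ι => μ).withDensity fun y =>
        ENNReal.ofReal (exp (∑ i, l (c i) (y i))) := by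
  have hp : ∀ i, IsProbabilityMeasure (μ.map (· + c i)) := fun i =>
    Measure.isProbabilityMeasure_map (measurable_add_const (c i)).aemeasurable
  have hp' : ∀ i, IsProbabilityMeasure
      (μ.withDensity fun y => ENNReal.ofReal (exp (l (c i) y))) := fun i => h (c i) ▸ hp i
  have h1 := pi_withDensity_prod (fun _ : ι => μ)
    (f := fun i y => ENNReal.ofReal (exp (l (c i) y))) fun i => (hl (c i)).exp.ennreal_ofReal
  simp_rw [← h] at h1
  rw [← Measure.pi_map_pi fun i => (measurable_add_const (c i)).aemeasurable] at h1
  refine h1.trans ?_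
  congr 1
  ext y
  rw [exp_sum, ENNReal.ofReal_prod_of_nonneg fun i _ => (exp_pos _).le]

lemma prod_map_add_eq_withDensity {E F : Type*} [MeasurableSpace E] [Add E] [MeasurableAdd₂ E]
    [MeasurableSpace F] [Add F] [MeasurableAdd₂ F] (μ : Measure E) [IsProbabilityMeasure μ]
    (ν : Measure F) [IsProbabilityMeasure ν] {l : E → E → ℝ} {k : F → F → ℝ}
    (hl : ∀ c, Measurable (l c)) (hk : ∀ c, Measurable (k c))
    (h : ∀ c, μ.map (· + c) = μ.withDensity fun y => ENNReal.ofReal (exp (l c y)))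
    (h' : ∀ c, ν.map (· + c) = ν.withDensity fun y => ENNReal.ofReal (exp (k c y))) (c : E × F) :
    (μ.prod ν).map (· + c) =
      (μ.prod ν).withDensity fun y => ENNReal.ofReal (exp (l c.1 y.1 + k c.2 y.2)) := by
  have h1 := Measure.map_prod_map μ ν (measurable_add_const c.1) (measurable_add_const c.2)
  rw [h, h', prod_withDensity (hl c.1).exp.ennreal_ofReal (hk c.2).exp.ennreal_ofReal] at h1
  refine h1.symm.trans ?_
  congr 1
  ext y
  rw [exp_add, ENNReal.ofReal_mul (exp_pos _).le]

/-- The Gaussian measure is invariant under reflection in the hyperplane orthogonal to `V`. -/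
lemma map_reflection_stdGaussian {k : ℕ} (V : Fin k → ℝ) :
    (stdGaussian k).map (fun z => z - (2 * (∑ j, V j * z j) / ∑ j, V j ^ 2) • V) =
      stdGaussian k := by
  set e := (ℝ ∙ (WithLp.toLp 2 V : EuclideanSpace ℝ (Fin k)))ᗮ.reflection with he
  have hR : (fun z : Fin k → ℝ => z - (2 * (∑ j, V j * z j) / ∑ j, V j ^ 2) • V) =
      WithLp.ofLp ∘ e ∘ WithLp.toLp 2 := by
    ext z j
    simp [he, Submodule.reflection_orthogonal_apply, Submodule.reflection_singleton_apply,
      EuclideanSpace.real_norm_sq_eq, PiLp.inner_apply]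
    simp only [mul_comm (z _)]
    ring
  have hmap : (stdGaussian k).map (WithLp.toLp 2) =
      ProbabilityTheory.stdGaussian (EuclideanSpace ℝ (Fin k)) := map_pi_eq_stdGaussian
  rw [hR, ← Measure.map_map (by fun_prop) (by fun_prop),
    ← Measure.map_map (by fun_prop) (by fun_prop), hmap, stdGaussian_map, ← hmap,
    Measure.map_map (by fun_prop) (by fun_prop)]
  exact Measure.map_id

end GaussianShift

section SpikedModel

open ProbabilityTheory hiding stdGaussian

/-- The Gaussian noises `(Z, Z̃, Z̄)`. -/
abbrev Noise (nu nv : ℕ) : Type :=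
  (Fin nu → Fin nv → ℝ) × (Fin nu → ℝ) × (Fin nv → ℝ)

/-- The law of the Gaussian noises. -/
def noiseLaw (nu nv : ℕ) : Measure (Noise nu nv) :=
  (stdGaussianMat nu nv).prod ((stdGaussian nu).prod (stdGaussian nv))

instance isProbabilityMeasure_noiseLaw (nu nv : ℕ) : IsProbabilityMeasure (noiseLaw nu nv) := by
  unfold noiseLaw; infer_instance

/-- The noiseless observations of the signal `(u, v)`. -/
def channel {nu nv : ℕ} (a b s : ℝ) (x : (Fin nu → ℝ) × (Fin nv → ℝ)) : Noise nu nv :=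
  (fun i j => a * x.1 i * x.2 j, fun i => b * x.1 i, fun j => s * x.2 j)

/-- The log-density at `y` of the Gaussian noise shifted by `w`. -/
def shiftLogDensity {nu nv : ℕ} (w y : Noise nu nv) : ℝ :=
  (∑ i, ∑ j, (w.1 i j * y.1 i j - w.1 i j ^ 2 / 2)) +
    (∑ i, (w.2.1 i * y.2.1 i - w.2.1 i ^ 2 / 2) + ∑ j, (w.2.2 j * y.2.2 j - w.2.2 j ^ 2 / 2))

/-- The log-likelihood of the signal `x` given the observations `y`. -/
def logLik {nu nv : ℕ} (a b s : ℝ) (x : (Fin nu → ℝ) × (Fin nv → ℝ)) (y : Noise nu nv) : ℝ :=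
  shiftLogDensity (channel a b s x) y

lemma noiseLaw_map_add {nu nv : ℕ} (w : Noise nu nv) :
    (noiseLaw nu nv).map (· + w) =
      (noiseLaw nu nv).withDensity fun y => ENNReal.ofReal (exp (shiftLogDensity w y)) := by
  have hvec : ∀ (k : ℕ) (c : Fin k → ℝ), (stdGaussian k).map (· + c) =
      (stdGaussian k).withDensity fun y =>
        ENNReal.ofReal (exp (∑ i, (c i * y i - c i ^ 2 / 2))) := fun k =>
    pi_map_add_eq_withDensity (gaussianReal 0 1) (l := fun c y => c * y - c ^ 2 / 2)
      (fun c => by fun_prop) gaussianReal_map_add_eq_withDensity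
  have hmat := pi_map_add_eq_withDensity (ι := Fin nu) (stdGaussian nv)
    (l := fun c y => ∑ i, (c i * y i - c i ^ 2 / 2)) (fun c => by fun_prop) (hvec nv)
  have hpair := prod_map_add_eq_withDensity (stdGaussian nu) (stdGaussian nv)
    (fun c => by fun_prop) (fun c => by fun_prop) (hvec nu) (hvec nv)
  exact prod_map_add_eq_withDensity (stdGaussianMat nu nv) ((stdGaussian nu).prod (stdGaussian nv))
    (l := fun c y => ∑ i, ∑ j, (c i j * y i j - c i j ^ 2 / 2))
    (k := fun c y => ∑ i, (c.1 i * y.1 i - c.1 i ^ 2 / 2) + ∑ j, (c.2 j * y.2 j - c.2 j ^ 2 / 2))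
    (fun c => by fun_prop) (fun c => by fun_prop) hmat hpair w

lemma continuous_channel {nu nv : ℕ} (a b s : ℝ) :
    Continuous (channel a b s : (Fin nu → ℝ) × (Fin nv → ℝ) → Noise nu nv) := by
  unfold channel; fun_prop

lemma continuous_logLik {nu nv : ℕ} (a b s : ℝ) :
    Continuous fun p : ((Fin nu → ℝ) × (Fin nv → ℝ)) × Noise nu nv => logLik a b s p.1 p.2 := by
  unfold logLik shiftLogDensity channel; fun_prop

lemma neg_interpH_eq_logLik {n nu nv : ℕ} {au av t Ru Rv : ℝ} (ht : 0 ≤ (1 - t) / n)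
    (hu : 0 ≤ au * Ru) (hv : 0 ≤ av * Rv) (U : Fin nu → ℝ) (V : Fin nv → ℝ)
    (Z : Fin nu → Fin nv → ℝ) (Zt : Fin nu → ℝ) (Zb : Fin nv → ℝ) (u : Fin nu → ℝ)
    (v : Fin nv → ℝ) :
    -interpH n nu nv au av t Ru Rv U V Z Zt Zb u v =
      logLik √((1 - t) / n) √(av * Rv) √(au * Ru) (u, v)
        ((Z, Zt, Zb) + channel √((1 - t) / n) √(av * Rv) √(au * Ru) (U, V)) := by
  unfold interpH logLik shiftLogDensity channel
  rw [neg_add, neg_add, add_assoc]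
  simp only [← Finset.sum_neg_distrib, Prod.mk_add_mk, Pi.add_apply]
  have h1 := Real.sq_sqrt ht
  have h2 := Real.sq_sqrt hu
  have h3 := Real.sq_sqrt hv
  congr 1
  · refine Finset.sum_congr rfl fun i _ => Finset.sum_congr rfl fun j _ => ?_
    rw [show (1 - t) / (2 * (n : ℝ)) = (1 - t) / n / 2 by rw [div_div, mul_comm], ← h1,
      Real.sqrt_sq (Real.sqrt_nonneg _)]
    ring
  congr 1
  · refine Finset.sum_congr rfl fun i _ => ?_
    rw [← h3, Real.sqrt_sq (Real.sqrt_nonneg _)]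
    ring
  · refine Finset.sum_congr rfl fun i _ => ?_
    rw [← h2, Real.sqrt_sq (Real.sqrt_nonneg _)]
    ring

lemma integrable_of_continuous_of_ae_bounded {X : Type*} [NormedAddCommGroup X] [ProperSpace X]
    [MeasurableSpace X] [BorelSpace X] {P : Measure X} [IsFiniteMeasure P] {C : ℝ}
    (hP : ∀ᵐ x ∂P, ‖x‖ ≤ C) {f : X → ℝ} (hf : Continuous f)
    (hfm : AEStronglyMeasurable f P) : Integrable f P := by
  obtain ⟨M, hM⟩ := (isCompact_closedBall (0 : X) C).exists_bound_of_continuousOn hf.continuousOn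
  exact .of_bound hfm M (hP.mono fun x hx => hM x (mem_closedBall_zero_iff.2 hx))

lemma IsUniformSphere.ae_norm_le {k : ℕ} {r : ℝ} {P : Measure (Fin k → ℝ)}
    (hP : IsUniformSphere k r P) : ∀ᵐ x ∂P, ‖x‖ ≤ |r| := by
  filter_upwards [hP.2.1] with x hx
  refine (pi_norm_le_iff_of_nonneg (abs_nonneg r)).2 fun i => ?_
  rw [Real.norm_eq_abs]
  exact sq_le_sq.1 (hx ▸ Finset.single_le_sum (f := fun i => x i ^ 2)
    (fun i _ => sq_nonneg _) (Finset.mem_univ i))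

lemma Efull_eq_integral {nu nv : ℕ} {Pu : Measure (Fin nu → ℝ)} {Pv : Measure (Fin nv → ℝ)}
    [IsProbabilityMeasure Pu] [IsProbabilityMeasure Pv]
    {g : ((Fin nu → ℝ) × (Fin nv → ℝ)) × Noise nu nv → ℝ}
    (hg : Integrable g ((Pu.prod Pv).prod (noiseLaw nu nv))) :
    Efull nu nv Pu Pv (fun U V Z Zt Zb => g ((U, V), (Z, Zt, Zb))) =
      ∫ p, g p ∂((Pu.prod Pv).prod (noiseLaw nu nv)) := by
  rw [integral_prod _ hg, integral_prod _ hg.integral_prod_left]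
  unfold Efull
  refine integral_congr_ae ?_
  filter_upwards [Measure.ae_ae_of_ae_prod hg.prod_right_ae] with U hU
  refine integral_congr_ae ?_
  filter_upwards [hU] with V hV
  unfold noiseLaw at hV ⊢
  rw [integral_prod _ hV]
  refine integral_congr_ae ?_
  filter_upwards [hV.prod_right_ae] with Z hZ
  rw [integral_prod _ hZ]

section Posterior

variable {nu nv : ℕ} {Pu : Measure (Fin nu → ℝ)} {Pv : Measure (Fin nv → ℝ)}
  {C : ℝ}

lemma ae_norm_prod_le (hPu : ∀ᵐ u ∂Pu, ‖u‖ ≤ C) (hPv : ∀ᵐ v ∂Pv, ‖v‖ ≤ C) :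
    ∀ᵐ x ∂(Pu.prod Pv), ‖x‖ ≤ C := by
  filter_upwards [Measure.quasiMeasurePreserving_fst.ae hPu,
    Measure.quasiMeasurePreserving_snd.ae hPv] with x h1 h2
  exact max_le h1 h2

variable [IsProbabilityMeasure Pu] [IsProbabilityMeasure Pv]

lemma integrable_mul_exp_logLik (hP : ∀ᵐ x ∂(Pu.prod Pv), ‖x‖ ≤ C) (a b s : ℝ) (y : Noise nu nv)
    {f : (Fin nu → ℝ) × (Fin nv → ℝ) → ℝ} (hf : Continuous f) :
    Integrable (fun x => f x * exp (logLik a b s x y)) (Pu.prod Pv) := by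
  have hl : Continuous fun x => logLik a b s x y := by
    unfold logLik shiftLogDensity channel; fun_prop
  have h : Continuous fun x => f x * exp (logLik a b s x y) := hf.mul (continuous_exp.comp hl)
  exact integrable_of_continuous_of_ae_bounded hP h h.aestronglyMeasurable

lemma gibbs_eq_integral_div {n : ℕ} {au av t Ru Rv : ℝ} (hP : ∀ᵐ x ∂(Pu.prod Pv), ‖x‖ ≤ C)
    (ht : 0 ≤ (1 - t) / n) (hu : 0 ≤ au * Ru) (hv : 0 ≤ av * Rv) (U : Fin nu → ℝ) (V : Fin nv → ℝ)
    (Z : Fin nu → Fin nv → ℝ) (Zt : Fin nu → ℝ) (Zb : Fin nv → ℝ)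
    {f : (Fin nu → ℝ) → (Fin nv → ℝ) → ℝ} (hf : Continuous fun x : _ × _ => f x.1 x.2) :
    gibbs n nu nv au av t Ru Rv Pu Pv U V Z Zt Zb f =
      (∫ x, f x.1 x.2 * exp (logLik √((1 - t) / n) √(av * Rv) √(au * Ru) x
        ((Z, Zt, Zb) + channel √((1 - t) / n) √(av * Rv) √(au * Ru) (U, V))) ∂(Pu.prod Pv)) /
      ∫ x, exp (logLik √((1 - t) / n) √(av * Rv) √(au * Ru) x
        ((Z, Zt, Zb) + channel √((1 - t) / n) √(av * Rv) √(au * Ru) (U, V))) ∂(Pu.prod Pv) := by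
  have h1 := integrable_mul_exp_logLik hP √((1 - t) / n) √(av * Rv) √(au * Ru)
    ((Z, Zt, Zb) + channel √((1 - t) / n) √(av * Rv) √(au * Ru) (U, V)) hf
  have h2 := integrable_mul_exp_logLik hP √((1 - t) / n) √(av * Rv) √(au * Ru)
    ((Z, Zt, Zb) + channel √((1 - t) / n) √(av * Rv) √(au * Ru) (U, V))
    (continuous_const (y := (1 : ℝ)))
  simp only [one_mul] at h2
  rw [integral_prod _ h1, integral_prod _ h2]
  simp only [gibbs, partFun, neg_interpH_eq_logLik ht hu hv]

/-- The joint law of the signal, the noise and a posterior sample. -/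
abbrev spikedLaw (n : ℕ) (au av t Ru Rv : ℝ) (Pu : Measure (Fin nu → ℝ))
    (Pv : Measure (Fin nv → ℝ)) :
    Measure ((((Fin nu → ℝ) × (Fin nv → ℝ)) × Noise nu nv) × ((Fin nu → ℝ) × (Fin nv → ℝ))) :=
  posteriorLaw (Pu.prod Pv) (noiseLaw nu nv)
    (channel √((1 - t) / n) √(av * Rv) √(au * Ru)) (logLik √((1 - t) / n) √(av * Rv) √(au * Ru))

lemma Efull_gibbs_eq_integral {n : ℕ} {au av t Ru Rv : ℝ} (hP : ∀ᵐ x ∂(Pu.prod Pv), ‖x‖ ≤ C)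
    (ht : 0 ≤ (1 - t) / n) (hu : 0 ≤ au * Ru) (hv : 0 ≤ av * Rv)
    {F : (((Fin nu → ℝ) × (Fin nv → ℝ)) × Noise nu nv) × ((Fin nu → ℝ) × (Fin nv → ℝ)) → ℝ}
    (hF : Integrable F (spikedLaw n au av t Ru Rv Pu Pv)) (hFc : Continuous F) :
    Efull nu nv Pu Pv (fun U V Z Zt Zb => gibbs n nu nv au av t Ru Rv Pu Pv U V Z Zt Zb
      (fun u v => F (((U, V), (Z, Zt, Zb)), (u, v)))) =
      ∫ ω, F ω ∂(spikedLaw n au av t Ru Rv Pu Pv) := by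
  have hm := (continuous_channel (nu := nu) (nv := nv)
    √((1 - t) / n) √(av * Rv) √(au * Ru)).measurable
  have hΛ := (continuous_logLik (nu := nu) (nv := nv)
    √((1 - t) / n) √(av * Rv) √(au * Ru)).measurable
  have hG := (integrable_density_mul hm hΛ hF).integral_prod_left
  simp only [integral_div] at hG
  rw [integral_posteriorLaw hm hΛ hF, ← Efull_eq_integral hG]
  congr 1
  ext U V Z Zt Zb
  exact gibbs_eq_integral_div hP ht hu hv U V Z Zt Zb (hFc.comp (by fun_prop :
    Continuous fun x : (Fin nu → ℝ) × (Fin nv → ℝ) =>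
      ((((U, V), (Z, Zt, Zb)), (x.1, x.2)) : (_ × Noise nu nv) × _)))

end Posterior

/-- Tilting by `e^{d f}` moves the mean of `f` in the direction of `d`. -/
lemma mul_tilted_mean_sub_mean_nonneg {X : Type*} [MeasurableSpace X] {P : Measure X} {f w : X → ℝ}
    {d : ℝ} (hw : ∀ x, 0 < w x) (hP : P ≠ 0) (h1 : Integrable w P)
    (h2 : Integrable (fun x => f x * w x) P) (h3 : Integrable (fun x => w x * exp (d * f x)) P)
    (h4 : Integrable (fun x => f x * (w x * exp (d * f x))) P) :
    0 ≤ d * ((∫ x, f x * (w x * exp (d * f x)) ∂P) / (∫ x, w x * exp (d * f x) ∂P) -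
      (∫ x, f x * w x ∂P) / ∫ x, w x ∂P) := by
  have hpos : ∀ g : X → ℝ, (∀ x, 0 < g x) → Integrable g P → 0 < ∫ x, g x ∂P := fun g hg hi => by
    rw [integral_pos_iff_support_of_nonneg (fun x => (hg x).le) hi,
      show Function.support g = univ from Set.eq_univ_of_forall fun x => (hg x).ne']
    exact Measure.measure_univ_pos.2 hP
  have hW := hpos w hw h1
  have hW' := hpos _ (fun x => mul_pos (hw x) (exp_pos _)) h3
  set m := (∫ x, f x * w x ∂P) / ∫ x, w x ∂P with hm
  have hmw : ∫ x, f x * w x ∂P = m * ∫ x, w x ∂P := by rw [hm, div_mul_cancel₀ _ hW.ne']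
  have hpt : ∀ x, 0 ≤ d * ((f x - m) * (w x * exp (d * f x) - w x * exp (d * m))) := fun x => by
    have : 0 ≤ (d * f x - d * m) * (exp (d * f x) - exp (d * m)) := by
      rcases le_total (d * m) (d * f x) with h | h
      · exact mul_nonneg (sub_nonneg.2 h) (sub_nonneg.2 (exp_le_exp.2 h))
      · exact mul_nonneg_of_nonpos_of_nonpos (sub_nonpos.2 h) (sub_nonpos.2 (exp_le_exp.2 h))
    have := mul_nonneg (hw x).le this
    linarith
  have hint : ∫ x, d * ((f x - m) * (w x * exp (d * f x) - w x * exp (d * m))) ∂P =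
      d * ((∫ x, f x * (w x * exp (d * f x)) ∂P) - m * ∫ x, w x * exp (d * f x) ∂P) := by
    rw [integral_const_mul]
    have : ∀ x, (f x - m) * (w x * exp (d * f x) - w x * exp (d * m)) =
        (f x * (w x * exp (d * f x)) - m * (w x * exp (d * f x))) -
          (f x * w x - m * w x) * exp (d * m) := fun x => by ring
    simp_rw [this]
    have hA : Integrable (fun x => f x * (w x * exp (d * f x)) - m * (w x * exp (d * f x))) P :=
      h4.sub (h3.const_mul m)
    have hB : Integrable (fun x => (f x * w x - m * w x) * exp (d * m)) P :=
      (h2.sub (h1.const_mul m)).mul_const _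
    rw [integral_sub hA hB,
      integral_sub h4 (h3.const_mul m), integral_mul_const, integral_sub h2 (h1.const_mul m),
      integral_const_mul, integral_const_mul, hmw, sub_self, zero_mul, sub_zero]
  have h := (integral_nonneg hpt).trans_eq hint
  rw [show d * ((∫ x, f x * (w x * exp (d * f x)) ∂P) / (∫ x, w x * exp (d * f x) ∂P) - m) =
    d * ((∫ x, f x * (w x * exp (d * f x)) ∂P) - m * ∫ x, w x * exp (d * f x) ∂P) /
      ∫ x, w x * exp (d * f x) ∂P by field_simp]
  exact div_nonneg h hW'.le

section Overlap

variable {nu nv : ℕ} {Pu : Measure (Fin nu → ℝ)} {Pv : Measure (Fin nv → ℝ)} {C : ℝ}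

lemma logLik_add_smul (hnv : 0 < nv) (a b s d : ℝ) (x : (Fin nu → ℝ) × (Fin nv → ℝ))
    (V z : Fin nv → ℝ) (Z : Fin nu → Fin nv → ℝ) (Zt : Fin nu → ℝ) (w : Noise nu nv) :
    logLik a b s x ((Z, Zt, z + d • V) + w) =
      logLik a b s x ((Z, Zt, z) + w) + s * d * nv * overlapV nv x.2 V := by
  have hnv' : (nv : ℝ) ≠ 0 := by positivity
  have h : s * d * nv * overlapV nv x.2 V = ∑ j, s * x.2 j * (d * V j) := by
    rw [overlapV, ← mul_assoc, mul_assoc (s * d), mul_one_div_cancel hnv', mul_one, Finset.mul_sum]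
    exact Finset.sum_congr rfl fun j _ => by ring
  rw [h]
  unfold logLik shiftLogDensity channel
  simp only [Prod.fst_add, Prod.snd_add, Pi.add_apply, Pi.smul_apply, smul_eq_mul]
  rw [add_assoc, add_assoc, ← Finset.sum_add_distrib]
  congr 2
  exact Finset.sum_congr rfl fun j _ => by ring

lemma exists_bound_signal_sample {n : ℕ} {au av t Ru Rv : ℝ}
    (hP : ∀ᵐ x ∂(Pu.prod Pv), ‖x‖ ≤ C)
    {φ : ((Fin nu → ℝ) × (Fin nv → ℝ)) × ((Fin nu → ℝ) × (Fin nv → ℝ)) → ℝ} (hφ : Continuous φ) :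
    ∃ M, ∀ᵐ ω ∂(spikedLaw n au av t Ru Rv Pu Pv), ‖φ (ω.1.1, ω.2)‖ ≤ M := by
  obtain ⟨M, hM⟩ := (isCompact_closedBall
    (0 : ((Fin nu → ℝ) × (Fin nv → ℝ)) × ((Fin nu → ℝ) × (Fin nv → ℝ)))
    C).exists_bound_of_continuousOn hφ.continuousOn
  refine ⟨M, ?_⟩
  have hac : spikedLaw n au av t Ru Rv Pu Pv ≪
      ((Pu.prod Pv).prod (noiseLaw nu nv)).prod (Pu.prod Pv) :=
    withDensity_absolutelyContinuous _ _
  filter_upwards [hac.ae_le ((Measure.quasiMeasurePreserving_fst.comp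
    Measure.quasiMeasurePreserving_fst).ae hP),
    hac.ae_le (Measure.quasiMeasurePreserving_snd.ae hP)] with ω h1 h2
  exact hM _ (mem_closedBall_zero_iff.2 (max_le h1 h2))

variable [IsProbabilityMeasure Pu] [IsProbabilityMeasure Pv]

/-- The posterior mean of the overlap `Q_v` is positively correlated with the noise along `V`. -/
lemma integral_gibbs_overlapV_mul_noise_nonneg {n : ℕ} {au av t Ru Rv : ℝ} (hnv : 0 < nv)
    (hP : ∀ᵐ x ∂(Pu.prod Pv), ‖x‖ ≤ C) (ht : 0 ≤ (1 - t) / n) (hu : 0 < au * Ru)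
    (hv : 0 ≤ av * Rv) (U : Fin nu → ℝ) (V : Fin nv → ℝ) (Z : Fin nu → Fin nv → ℝ)
    (Zt : Fin nu → ℝ) :
    0 ≤ ∫ Zb, gibbs n nu nv au av t Ru Rv Pu Pv U V Z Zt Zb
      (fun _ v => overlapV nv v V * ∑ j, V j * Zb j) ∂(stdGaussian nv) := by
  set a := √((1 - t) / n)
  set b := √(av * Rv)
  set s := √(au * Ru) with hs
  have hs0 : 0 < s := Real.sqrt_pos.2 hu
  have hnv' : (0 : ℝ) < nv := by positivity
  set w : (Fin nv → ℝ) → (Fin nu → ℝ) × (Fin nv → ℝ) → ℝ := fun z x =>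
    exp (logLik a b s x ((Z, Zt, z) + channel a b s (U, V))) with hw
  set g : (Fin nv → ℝ) → ℝ := fun z =>
    (∫ x, overlapV nv x.2 V * w z x ∂(Pu.prod Pv)) / ∫ x, w z x ∂(Pu.prod Pv) with hg
  have hQ : Continuous fun x : (Fin nu → ℝ) × (Fin nv → ℝ) => overlapV nv x.2 V := by
    unfold overlapV; fun_prop
  have hgibbs : ∀ z, gibbs n nu nv au av t Ru Rv Pu Pv U V Z Zt z
      (fun _ v => overlapV nv v V * ∑ j, V j * z j) = (∑ j, V j * z j) * g z := fun z => by
    rw [gibbs_eq_integral_div hP ht hu.le hv U V Z Zt z (hQ.mul continuous_const), hg,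
      ← mul_div_assoc, ← integral_const_mul]
    congr 2
    ext x
    simp only [hw]
    ring
  simp_rw [hgibbs]
  have hmono : ∀ z d, 0 ≤ d * (g (z + d • V) - g z) := fun z d => by
    have hwd : ∀ x, w (z + d • V) x = w z x * exp (s * d * nv * overlapV nv x.2 V) := fun x => by
      change exp (logLik a b s x ((Z, Zt, z + d • V) + channel a b s (U, V))) =
        exp (logLik a b s x ((Z, Zt, z) + channel a b s (U, V))) * _
      rw [logLik_add_smul hnv, Real.exp_add]
    have hi : ∀ z', Integrable (w z') (Pu.prod Pv) := fun z' => by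
      simpa only [one_mul] using integrable_mul_exp_logLik hP a b s
        ((Z, Zt, z') + channel a b s (U, V)) (continuous_const (y := (1 : ℝ)))
    have hi' : ∀ z', Integrable (fun x => overlapV nv x.2 V * w z' x) (Pu.prod Pv) := fun z' =>
      integrable_mul_exp_logLik hP a b s _ hQ
    have h3 := hi (z + d • V)
    have h4 := hi' (z + d • V)
    rw [funext hwd] at h3
    rw [funext hwd] at h4
    have h := mul_tilted_mean_sub_mean_nonneg (fun x => exp_pos _) (NeZero.ne (Pu.prod Pv))
      (hi z) (hi' z) h3 h4
    have hgd : g (z + d • V) =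
        (∫ x, overlapV nv x.2 V * (w z x * exp (s * d * nv * overlapV nv x.2 V)) ∂(Pu.prod Pv)) /
          ∫ x, w z x * exp (s * d * nv * overlapV nv x.2 V) ∂(Pu.prod Pv) := by
      change (∫ x, overlapV nv x.2 V * w (z + d • V) x ∂(Pu.prod Pv)) /
        ∫ x, w (z + d • V) x ∂(Pu.prod Pv) = _
      rw [funext hwd]
    have h' : 0 ≤ (s * nv) * (d * (g (z + d • V) - g z)) := by
      rw [hgd]
      exact h.trans_eq (by rw [hg]; ring)
    exact nonneg_of_mul_nonneg_right h' (by positivity)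
  by_cases hint : Integrable (fun z => (∑ j, V j * z j) * g z) (stdGaussian nv)
  swap
  · rw [integral_undef hint]
  set R : (Fin nv → ℝ) → (Fin nv → ℝ) :=
    fun z => z - (2 * (∑ j, V j * z j) / ∑ j, V j ^ 2) • V with hR
  have hRm : Measurable R := by fun_prop
  have hmap : (stdGaussian nv).map R = stdGaussian nv := map_reflection_stdGaussian V
  have hint' : Integrable (fun z => (∑ j, V j * R z j) * g (R z)) (stdGaussian nv) :=
    (hmap ▸ hint).comp_measurable hRm
  have heq : ∫ z, (∑ j, V j * R z j) * g (R z) ∂(stdGaussian nv) =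
      ∫ z, (∑ j, V j * z j) * g z ∂(stdGaussian nv) := by
    conv_rhs => rw [← hmap]
    exact (integral_map hRm.aemeasurable (hmap ▸ hint.1)).symm
  have hsq : ∀ e, ∑ j, V j * (e * V j) = e * ∑ j, V j ^ 2 := fun e => by
    rw [Finset.mul_sum]
    exact Finset.sum_congr rfl fun j _ => by ring
  have hpt : ∀ z, 0 ≤ (∑ j, V j * z j) * g z + (∑ j, V j * R z j) * g (R z) := fun z => by
    set c := ∑ j, V j * z j with hc
    set q := ∑ j, V j ^ 2 with hq
    have hq0 : 0 ≤ q := Finset.sum_nonneg fun j _ => sq_nonneg _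
    have hRz : ∑ j, V j * R z j = c - 2 * c / q * q := by
      simp only [hR, Pi.sub_apply, Pi.smul_apply, smul_eq_mul, mul_sub, Finset.sum_sub_distrib]
      rw [hsq]
    rcases hq0.eq_or_lt with h0 | h0
    · have hV : ∀ j, V j = 0 := fun j => by
        have := (Finset.sum_eq_zero_iff_of_nonneg fun j _ => sq_nonneg (V j)).1 h0.symm j
          (Finset.mem_univ j)
        simpa using this
      have hc0 : c = 0 := by simp [hc, hV]
      rw [hRz, hc0]
      simp
    · have h := hmono (R z) (2 * c / q)
      rw [show R z + (2 * c / q) • V = z by simp [hR, hc, hq]] at h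
      rw [hRz, div_mul_cancel₀ _ h0.ne']
      have h' := mul_nonneg h (half_pos h0).le
      have : 2 * c / q * (g z - g (R z)) * (q / 2) = c * (g z - g (R z)) := by
        field_simp
      linarith
  have hsum : 0 ≤ ∫ z, ((∑ j, V j * z j) * g z + (∑ j, V j * R z j) * g (R z))
      ∂(stdGaussian nv) := integral_nonneg hpt
  rw [integral_add hint hint', heq] at hsum
  linarith

lemma measurePreserving_fst_spikedLaw {n : ℕ} {au av t Ru Rv : ℝ}
    (hP : ∀ᵐ x ∂(Pu.prod Pv), ‖x‖ ≤ C) :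
    MeasurePreserving Prod.fst (spikedLaw n au av t Ru Rv Pu Pv)
      ((Pu.prod Pv).prod (noiseLaw nu nv)) := by
  refine ⟨measurable_fst, map_fst_posteriorLaw (continuous_channel _ _ _).measurable
    (continuous_logLik _ _ _).measurable fun y => ?_⟩
  simpa only [one_mul] using integrable_mul_exp_logLik hP _ _ _ y (continuous_const (y := (1 : ℝ)))

lemma measurePreserving_noise_coord (j : Fin nv) :
    MeasurePreserving (fun z : Noise nu nv => z.2.2 j) (noiseLaw nu nv) (gaussianReal 0 1) :=
  (measurePreserving_eval (fun _ : Fin nv => gaussianReal 0 1) j).comp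
    ((measurePreserving_snd (μ := stdGaussian nu) (ν := stdGaussian nv)).comp
      (measurePreserving_snd (μ := stdGaussianMat nu nv)))

lemma memLp_signal_sample_mul_noise {n : ℕ} {au av t Ru Rv : ℝ}
    (hP : ∀ᵐ x ∂(Pu.prod Pv), ‖x‖ ≤ C)
    {φ : ((Fin nu → ℝ) × (Fin nv → ℝ)) × ((Fin nu → ℝ) × (Fin nv → ℝ)) → ℝ} (hφ : Continuous φ)
    (j : Fin nv) :
    MemLp (fun ω => φ (ω.1.1, ω.2) * ω.1.2.2.2 j) 2 (spikedLaw n au av t Ru Rv Pu Pv) := by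
  obtain ⟨M, hM⟩ := exists_bound_signal_sample (n := n) (au := au) (av := av) (t := t) (Ru := Ru)
    (Rv := Rv) hP hφ
  have hz := (memLp_id_gaussianReal (μ := 0) (v := 1) 2).comp_measurePreserving
    ((measurePreserving_noise_coord (nu := nu) j).comp (measurePreserving_snd.comp
      (measurePreserving_fst_spikedLaw (n := n) (au := au) (av := av) (t := t) (Ru := Ru)
        (Rv := Rv) hP)))
  refine hz.of_le_mul (c := M) (Continuous.aestronglyMeasurable (by fun_prop)) ?_
  filter_upwards [hM] with ω h
  rw [norm_mul]
  exact mul_le_mul_of_nonneg_right h (norm_nonneg _)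

lemma isProbabilityMeasure_spikedLaw {n : ℕ} {au av t Ru Rv : ℝ}
    (hP : ∀ᵐ x ∂(Pu.prod Pv), ‖x‖ ≤ C) :
    IsProbabilityMeasure (spikedLaw n au av t Ru Rv Pu Pv) := by
  have h := measurePreserving_fst_spikedLaw (n := n) (au := au) (av := av) (t := t) (Ru := Ru)
    (Rv := Rv) hP
  have : IsProbabilityMeasure ((spikedLaw n au av t Ru Rv Pu Pv).map Prod.fst) := by
    rw [h.map_eq]; infer_instance
  exact Measure.isProbabilityMeasure_of_map Prod.fst

lemma memLp_signal_sample {n : ℕ} {au av t Ru Rv : ℝ}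
    (hP : ∀ᵐ x ∂(Pu.prod Pv), ‖x‖ ≤ C)
    {φ : ((Fin nu → ℝ) × (Fin nv → ℝ)) × ((Fin nu → ℝ) × (Fin nv → ℝ)) → ℝ}
    (hφ : Continuous φ) :
    MemLp (fun ω => φ (ω.1.1, ω.2)) 2 (spikedLaw n au av t Ru Rv Pu Pv) := by
  have := isProbabilityMeasure_spikedLaw (n := n) (au := au) (av := av) (t := t) (Ru := Ru)
    (Rv := Rv) hP
  obtain ⟨M, hM⟩ := exists_bound_signal_sample (n := n) (au := au) (av := av) (t := t) (Ru := Ru)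
    (Rv := Rv) hP hφ
  exact .of_bound (Continuous.aestronglyMeasurable (by fun_prop)) M hM

lemma integral_signal_mul_noise {n : ℕ} {au av t Ru Rv : ℝ} (hP : ∀ᵐ x ∂(Pu.prod Pv), ‖x‖ ≤ C)
    (j : Fin nv) :
    ∫ ω, ω.1.1.2 j * ω.1.2.2.2 j ∂(spikedLaw n au av t Ru Rv Pu Pv) = 0 := by
  have h := measurePreserving_fst_spikedLaw (n := n) (au := au) (av := av) (t := t) (Ru := Ru)
    (Rv := Rv) hP
  have h1 : ∫ p, p.1.2 j * p.2.2.2 j ∂((spikedLaw n au av t Ru Rv Pu Pv).map Prod.fst) =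
      ∫ ω, ω.1.1.2 j * ω.1.2.2.2 j ∂(spikedLaw n au av t Ru Rv Pu Pv) :=
    integral_map measurable_fst.aemeasurable (Continuous.aestronglyMeasurable (by fun_prop))
  have hz := measurePreserving_noise_coord (nu := nu) j
  have h2 : ∫ x, x ∂((noiseLaw nu nv).map fun z => z.2.2 j) = ∫ z, z.2.2 j ∂(noiseLaw nu nv) :=
    integral_map hz.aemeasurable (Continuous.aestronglyMeasurable (by fun_prop))
  rw [hz.map_eq, integral_id_gaussianReal] at h2
  rw [← h1, h.map_eq, integral_prod_mul (fun x : (Fin nu → ℝ) × (Fin nv → ℝ) => x.2 j)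
    (fun z : Noise nu nv => z.2.2 j), ← h2, mul_zero]

lemma memLp_overlapV {n : ℕ} {au av t Ru Rv : ℝ} (hP : ∀ᵐ x ∂(Pu.prod Pv), ‖x‖ ≤ C) :
    MemLp (fun ω => overlapV nv ω.2.2 ω.1.1.2) 2 (spikedLaw n au av t Ru Rv Pu Pv) :=
  memLp_signal_sample hP (φ := fun p => overlapV nv p.2.2 p.1.2) (by unfold overlapV; fun_prop)

lemma memLp_calL {n : ℕ} {au av t Ru Rv : ℝ} (hP : ∀ᵐ x ∂(Pu.prod Pv), ‖x‖ ≤ C) :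
    MemLp (fun ω => calL n nv au Ru ω.2.2 ω.1.1.2 ω.1.2.2.2) 2
      (spikedLaw n au av t Ru Rv Pu Pv) := by
  have h1 : ∀ j : Fin nv, MemLp (fun ω => au / 2 * ω.2.2 j ^ 2 - au * ω.2.2 j * ω.1.1.2 j) 2
      (spikedLaw n au av t Ru Rv Pu Pv) := fun j =>
    memLp_signal_sample hP (φ := fun p => au / 2 * p.2.2 j ^ 2 - au * p.2.2 j * p.1.2 j)
      (by fun_prop)
  have h2 : ∀ j : Fin nv, MemLp (fun ω => 1 / 2 * √(au / Ru) * ω.2.2 j * ω.1.2.2.2 j) 2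
      (spikedLaw n au av t Ru Rv Pu Pv) := fun j =>
    memLp_signal_sample_mul_noise hP (φ := fun p => 1 / 2 * √(au / Ru) * p.2.2 j)
      (by fun_prop) j
  unfold calL
  exact (memLp_finsetSum Finset.univ fun j _ => (h1 j).sub (h2 j)).const_mul _

lemma memLp_sum_signal_mul_noise {n : ℕ} {au av t Ru Rv : ℝ}
    (hP : ∀ᵐ x ∂(Pu.prod Pv), ‖x‖ ≤ C) :
    MemLp (fun ω => ∑ j, ω.1.1.2 j * ω.1.2.2.2 j) 2 (spikedLaw n au av t Ru Rv Pu Pv) :=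
  memLp_finsetSum _ fun j _ =>
    memLp_signal_sample_mul_noise hP (φ := fun p => p.1.2 j) (by fun_prop) j

lemma integral_sum_signal_mul_noise {n : ℕ} {au av t Ru Rv : ℝ}
    (hP : ∀ᵐ x ∂(Pu.prod Pv), ‖x‖ ≤ C) :
    ∫ ω, ∑ j, ω.1.1.2 j * ω.1.2.2.2 j ∂(spikedLaw n au av t Ru Rv Pu Pv) = 0 := by
  have h : ∀ j : Fin nv, Integrable (fun ω => ω.1.1.2 j * ω.1.2.2.2 j)
      (spikedLaw n au av t Ru Rv Pu Pv) := fun j => by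
    have := isProbabilityMeasure_spikedLaw (n := n) (au := au) (av := av) (t := t) (Ru := Ru)
      (Rv := Rv) hP
    exact (memLp_signal_sample_mul_noise hP (φ := fun p => p.1.2 j) (by fun_prop) j).integrable
      one_le_two
  rw [integral_finsetSum _ fun j _ => h j]
  exact Finset.sum_eq_zero fun j _ => integral_signal_mul_noise hP j

/-- The part of `𝓛` that depends on the signal only through the observation `y`. -/
def residualL (n : ℕ) (au Ru : ℝ) (v : Fin nv → ℝ) (y : Noise nu nv) : ℝ :=
  (1 / (n : ℝ)) * ∑ j, (au / 2 * v j ^ 2 - 1 / 2 * √(au / Ru) * v j * y.2.2 j)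

lemma half_sqrt_div_mul_sqrt_mul {au Ru : ℝ} (hau : 0 < au) (hRu : 0 < Ru) :
    1 / 2 * √(au / Ru) * √(au * Ru) = au / 2 := by
  rw [mul_assoc, ← Real.sqrt_mul (by positivity),
    show au / Ru * (au * Ru) = au ^ 2 by field_simp, Real.sqrt_sq hau.le]
  ring

lemma calL_eq {n : ℕ} {au Ru : ℝ} (hnv : 0 < nv) (hau : 0 < au) (hRu : 0 < Ru) (a b : ℝ)
    (x : (Fin nu → ℝ) × (Fin nv → ℝ)) (v : Fin nv → ℝ) (z : Noise nu nv) :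
    calL n nv au Ru v x.2 z.2.2 = -(au / 2 * ((nv : ℝ) / n)) * overlapV nv v x.2 +
      residualL n au Ru v (z + channel a b √(au * Ru) x) := by
  have hnv' : (0 : ℝ) < nv := by positivity
  simp only [calL, overlapV, residualL, channel, Prod.snd_add, Pi.add_apply]
  have : -(au / 2 * ((nv : ℝ) / n)) * (1 / (nv : ℝ) * ∑ j, v j * x.2 j) =
      1 / (n : ℝ) * ∑ j, -(au / 2) * (v j * x.2 j) := by
    rw [← Finset.mul_sum]; field_simp
  rw [this, ← mul_add, ← Finset.sum_add_distrib]
  congr 1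
  refine Finset.sum_congr rfl fun j _ => ?_
  linear_combination (v j * x.2 j) * half_sqrt_div_mul_sqrt_mul hau hRu

lemma residualL_signal {n : ℕ} {au Ru : ℝ} (hau : 0 < au) (hRu : 0 < Ru) (a b : ℝ)
    (x : (Fin nu → ℝ) × (Fin nv → ℝ)) (z : Noise nu nv) :
    residualL n au Ru x.2 (z + channel a b √(au * Ru) x) =
      -(1 / 2 * √(au / Ru) / n) * ∑ j, x.2 j * z.2.2 j := by
  simp only [residualL, channel, Prod.snd_add, Pi.add_apply]
  have : -(1 / 2 * √(au / Ru) / n) * ∑ j, x.2 j * z.2.2 j =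
      1 / (n : ℝ) * ∑ j, -(1 / 2 * √(au / Ru)) * (x.2 j * z.2.2 j) := by
    rw [← Finset.mul_sum]; ring
  rw [this]
  congr 1
  refine Finset.sum_congr rfl fun j _ => ?_
  linear_combination -(x.2 j ^ 2) * half_sqrt_div_mul_sqrt_mul hau hRu

lemma measurable_residualL (n : ℕ) (au Ru : ℝ) :
    Measurable fun p : (Fin nv → ℝ) × Noise nu nv => residualL n au Ru p.1 p.2 := by
  unfold residualL; fun_prop

/-- The Nishimori identity: the signal and the posterior sample are exchangeable given the
observation. -/
lemma integral_spikedLaw_swap {n : ℕ} {au av t Ru Rv : ℝ}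
    {f : (Fin nv → ℝ) → (Fin nv → ℝ) → Noise nu nv → ℝ}
    (hf : Measurable fun p : (Fin nv → ℝ) × (Fin nv → ℝ) × Noise nu nv => f p.1 p.2.1 p.2.2) :
    ∫ ω, f ω.1.1.2 ω.2.2 (ω.1.2 + channel √((1 - t) / n) √(av * Rv) √(au * Ru) ω.1.1)
        ∂(spikedLaw n au av t Ru Rv Pu Pv) =
      ∫ ω, f ω.2.2 ω.1.1.2 (ω.1.2 + channel √((1 - t) / n) √(av * Rv) √(au * Ru) ω.1.1)
        ∂(spikedLaw n au av t Ru Rv Pu Pv) :=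
  integral_posteriorLaw_swap (P := Pu.prod Pv) (γ := noiseLaw nu nv)
    (continuous_channel _ _ _).measurable (continuous_logLik _ _ _).measurable
    (fun x => noiseLaw_map_add _) (f := fun x x' y => f x.2 x'.2 y) (hf.comp
      (g := fun p : (Fin nv → ℝ) × (Fin nv → ℝ) × Noise nu nv => f p.1 p.2.1 p.2.2)
      (f := fun p : ((Fin nu → ℝ) × (Fin nv → ℝ)) × ((Fin nu → ℝ) × (Fin nv → ℝ)) × Noise nu nv =>
        (p.1.2, p.2.1.2, p.2.2)) (by fun_prop))

lemma integral_residualL {n : ℕ} {au av t Ru Rv : ℝ} (hP : ∀ᵐ x ∂(Pu.prod Pv), ‖x‖ ≤ C)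
    (hau : 0 < au) (hRu : 0 < Ru) :
    ∫ ω, residualL n au Ru ω.2.2
      (ω.1.2 + channel √((1 - t) / n) √(av * Rv) √(au * Ru) ω.1.1)
      ∂(spikedLaw n au av t Ru Rv Pu Pv) = 0 := by
  rw [integral_spikedLaw_swap (f := fun _ v y => residualL n au Ru v y)
    ((measurable_residualL n au Ru).comp measurable_snd)]
  simp_rw [residualL_signal hau hRu]
  rw [integral_const_mul, integral_sum_signal_mul_noise hP, mul_zero]

lemma integral_overlapV_mul_residualL_nonpos {n : ℕ} {au av t Ru Rv : ℝ} (hnv : 0 < nv)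
    (hP : ∀ᵐ x ∂(Pu.prod Pv), ‖x‖ ≤ C) (ht : 0 ≤ (1 - t) / n) (hau : 0 < au) (hRu : 0 < Ru)
    (hv : 0 ≤ av * Rv) :
    ∫ ω, overlapV nv ω.2.2 ω.1.1.2 * residualL n au Ru ω.2.2
      (ω.1.2 + channel √((1 - t) / n) √(av * Rv) √(au * Ru) ω.1.1)
      ∂(spikedLaw n au av t Ru Rv Pu Pv) ≤ 0 := by
  have hu : 0 < au * Ru := mul_pos hau hRu
  rw [integral_spikedLaw_swap (f := fun V v y => overlapV nv v V * residualL n au Ru v y)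
    (Measurable.mul (by unfold overlapV; fun_prop)
      ((measurable_residualL n au Ru).comp measurable_snd))]
  have hsymm : ∀ v V : Fin nv → ℝ, overlapV nv v V = overlapV nv V v := fun v V => by
    simp only [overlapV, mul_comm]
  simp_rw [residualL_signal hau hRu, fun ω : (((Fin nu → ℝ) × (Fin nv → ℝ)) × Noise nu nv) ×
    ((Fin nu → ℝ) × (Fin nv → ℝ)) => hsymm ω.1.1.2 ω.2.2, mul_left_comm (overlapV _ _ _)]
  rw [integral_const_mul]
  refine mul_nonpos_of_nonpos_of_nonneg (neg_nonpos.2 (by positivity)) ?_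
  rw [← Efull_gibbs_eq_integral hP ht hu.le hv
    (F := fun ω => overlapV nv ω.2.2 ω.1.1.2 * ∑ j, ω.1.1.2 j * ω.1.2.2.2 j)
    ((memLp_overlapV hP).integrable_mul (memLp_sum_signal_mul_noise hP))
    (by unfold overlapV; fun_prop)]
  exact integral_nonneg fun U => integral_nonneg fun V => integral_nonneg fun Z =>
    integral_nonneg fun Zt => integral_gibbs_overlapV_mul_noise_nonneg hnv hP ht hu hv U V Z Zt

end Overlap

end SpikedModel

/-- If `L = -k Q + A` with `A` centred and nonpositively correlated with `Q`, then the variance of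
`L` is at least `k ^ 2` times that of `Q`. -/
lemma sq_mul_variance_le {Ω : Type*} [MeasurableSpace Ω] {ν : Measure Ω} [IsProbabilityMeasure ν]
    {Q A L : Ω → ℝ} {k q : ℝ} (hk : 0 ≤ k) (hQ : MemLp Q 2 ν) (hA : MemLp A 2 ν)
    (hL : ∀ ω, L ω = -k * Q ω + A ω) (hA0 : ∫ ω, A ω ∂ν = 0) (hQA : ∫ ω, Q ω * A ω ∂ν ≤ 0) :
    k ^ 2 * ∫ ω, (Q ω - q) ^ 2 ∂ν ≤ ∫ ω, (L ω - -k * q) ^ 2 ∂ν := by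
  have hexpand : ∀ ω, (L ω - -k * q) ^ 2 =
      k ^ 2 * (Q ω - q) ^ 2 + (A ω ^ 2 + (2 * k * q * A ω - 2 * k * (Q ω * A ω))) :=
    fun ω => by rw [hL]; ring
  have hQq : MemLp (fun ω => Q ω - q) 2 ν := hQ.sub (memLp_const q)
  have hA1 : Integrable A ν := hA.integrable one_le_two
  have hQAi : Integrable (fun ω => Q ω * A ω) ν := hQ.integrable_mul hA
  have hcross : Integrable (fun ω => 2 * k * q * A ω - 2 * k * (Q ω * A ω)) ν :=
    (hA1.const_mul _).sub (hQAi.const_mul _)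
  have hAsq := hA.integrable_sq
  have hrest : Integrable (fun ω => A ω ^ 2 + (2 * k * q * A ω - 2 * k * (Q ω * A ω))) ν :=
    hAsq.add hcross
  simp_rw [hexpand]
  rw [integral_add (hQq.integrable_sq.const_mul _) hrest, integral_add hAsq hcross,
    integral_sub (hA1.const_mul _) (hQAi.const_mul _), integral_const_mul, integral_const_mul,
    integral_const_mul, hA0]
  have h1 : 0 ≤ ∫ ω, A ω ^ 2 ∂ν := integral_nonneg fun ω => sq_nonneg _
  have h2 : 0 ≤ 2 * k * -∫ ω, Q ω * A ω ∂ν := mul_nonneg (by positivity) (neg_nonneg.2 hQA)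
  linarith

/-- **Lemma: fluctuations of `Q_v` controlled by `𝓛`.** For all
`(t,R) ∈ [0,1] × (0,∞)²`, one has `E⟨𝓛⟩ = −(α_u/2)(n_v/n) E⟨Q_v⟩` and
`E⟨(Q_v − E⟨Q_v⟩)²⟩ ≤ (4/α_u²)(n/n_v)² E⟨(𝓛 − E⟨𝓛⟩)²⟩`. -/
theorem overlap_fluctuation_controlled_by_calL
    (n nu nv : ℕ) (hn : 0 < n) (hnu : 0 < nu) (hnv : 0 < nv)
    (au av ru rv : ℝ) (hau : 0 < au) (hav : 0 < av) (hru : 0 < ru) (hrv : 0 < rv)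
    (Pu : Measure (Fin nu → ℝ)) (Pv : Measure (Fin nv → ℝ))
    (hPu : IsUniformSphere nu (Real.sqrt (ru * nu)) Pu)
    (hPv : IsUniformSphere nv (Real.sqrt (rv * nv)) Pv)
    (t : ℝ) (ht : t ∈ Icc (0:ℝ) 1) (Ru Rv : ℝ) (hRu : 0 < Ru) (hRv : 0 < Rv) :
    eL n nu nv au av t Ru Rv Pu Pv
        = -(au / 2) * ((nv : ℝ) / n) * eQv n nu nv au av t Ru Rv Pu Pv ∧
    Efull nu nv Pu Pv (fun U V Z Zt Zb =>
        gibbs n nu nv au av t Ru Rv Pu Pv U V Z Zt Zb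
          (fun _ v => (overlapV nv v V - eQv n nu nv au av t Ru Rv Pu Pv) ^ 2))
      ≤ (4 / au ^ 2) * ((n : ℝ) / nv) ^ 2 *
        Efull nu nv Pu Pv (fun U V Z Zt Zb =>
          gibbs n nu nv au av t Ru Rv Pu Pv U V Z Zt Zb
            (fun _ v => (calL n nv au Ru v V Zb - eL n nu nv au av t Ru Rv Pu Pv) ^ 2)) := by
  have := hPu.1
  have := hPv.1
  have hP : ∀ᵐ x ∂(Pu.prod Pv), ‖x‖ ≤ max |√(ru * nu)| |√(rv * nv)| :=
    ae_norm_prod_le (hPu.ae_norm_le.mono fun _ h => h.trans (le_max_left _ _))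
      (hPv.ae_norm_le.mono fun _ h => h.trans (le_max_right _ _))
  have ht' : 0 ≤ (1 - t) / n := div_nonneg (sub_nonneg.2 ht.2) n.cast_nonneg
  have hu : 0 ≤ au * Ru := (mul_pos hau hRu).le
  have hv : 0 ≤ av * Rv := (mul_pos hav hRv).le
  set k := au / 2 * ((nv : ℝ) / n) with hk
  have hk0 : 0 < k := by positivity
  set ν := spikedLaw n au av t Ru Rv Pu Pv
  have hνp : IsProbabilityMeasure ν := isProbabilityMeasure_spikedLaw hP
  let Ω := (((Fin nu → ℝ) × (Fin nv → ℝ)) × Noise nu nv) × ((Fin nu → ℝ) × (Fin nv → ℝ))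
  let Q : Ω → ℝ := fun ω => overlapV nv ω.2.2 ω.1.1.2
  let L : Ω → ℝ := fun ω => calL n nv au Ru ω.2.2 ω.1.1.2 ω.1.2.2.2
  let A : Ω → ℝ := fun ω => residualL n au Ru ω.2.2
    (ω.1.2 + channel √((1 - t) / n) √(av * Rv) √(au * Ru) ω.1.1)
  have hQc : Continuous Q := by simp only [Q, overlapV]; fun_prop
  have hLc : Continuous L := by simp only [L, calL]; fun_prop
  have hL : ∀ ω, L ω = -k * Q ω + A ω := fun ω => calL_eq hnv hau hRu _ _ ω.1.1 ω.2.2 ω.1.2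
  have hQ2 : MemLp Q 2 ν := memLp_overlapV hP
  have hL2 : MemLp L 2 ν := memLp_calL hP
  have hA2 : MemLp A 2 ν := by
    have : A = fun ω => L ω + k * Q ω := funext fun ω => by rw [hL]; ring
    rw [this]
    exact hL2.add (hQ2.const_mul k)
  have hQ1 : Integrable Q ν := hQ2.integrable one_le_two
  have hA1 : Integrable A ν := hA2.integrable one_le_two
  have hA0 : ∫ ω, A ω ∂ν = 0 := integral_residualL hP hau hRu
  have hQA : ∫ ω, Q ω * A ω ∂ν ≤ 0 :=
    integral_overlapV_mul_residualL_nonpos hnv hP ht' hau hRu hv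
  have heQ : eQv n nu nv au av t Ru Rv Pu Pv = ∫ ω, Q ω ∂ν :=
    Efull_gibbs_eq_integral hP ht' hu hv hQ1 hQc
  have heL : eL n nu nv au av t Ru Rv Pu Pv = ∫ ω, L ω ∂ν :=
    Efull_gibbs_eq_integral hP ht' hu hv (hL2.integrable one_le_two) hLc
  have hmean : ∫ ω, L ω ∂ν = -k * ∫ ω, Q ω ∂ν := by
    simp_rw [hL]
    rw [integral_add (hQ1.const_mul _) hA1, integral_const_mul, hA0, add_zero]
  rw [heL, heQ, hmean]
  set q := ∫ ω, Q ω ∂ν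
  refine ⟨by rw [hk]; ring, ?_⟩
  have hQq2 : MemLp (fun ω => Q ω - q) 2 ν := hQ2.sub (memLp_const q)
  have hLq2 : MemLp (fun ω => L ω - -k * q) 2 ν := hL2.sub (memLp_const _)
  have hEQ : Efull nu nv Pu Pv (fun U V Z Zt Zb => gibbs n nu nv au av t Ru Rv Pu Pv U V Z Zt Zb
      (fun _ v => (overlapV nv v V - q) ^ 2)) = ∫ ω, (Q ω - q) ^ 2 ∂ν :=
    Efull_gibbs_eq_integral hP ht' hu hv hQq2.integrable_sq
      ((hQc.sub continuous_const).pow 2)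
  have hEL : Efull nu nv Pu Pv (fun U V Z Zt Zb => gibbs n nu nv au av t Ru Rv Pu Pv U V Z Zt Zb
      (fun _ v => (calL n nv au Ru v V Zb - -k * q) ^ 2)) = ∫ ω, (L ω - -k * q) ^ 2 ∂ν :=
    Efull_gibbs_eq_integral hP ht' hu hv hLq2.integrable_sq
      ((hLc.sub continuous_const).pow 2)
  rw [hEQ, hEL]
  rw [show (4 / au ^ 2) * ((n : ℝ) / nv) ^ 2 = (k ^ 2)⁻¹ by rw [hk]; field_simp; norm_num,
    inv_mul_eq_div, le_div_iff₀' (by positivity)]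
  exact sq_mul_variance_le hk0.le hQ2 hA2 hL hA0 hQA

end
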